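/- For every integer p ≥ 7, there is no normal locally finite face-to-face tiling of ℝ² by convex polygons each having exactly p extreme points; that is, normality cannot be achieved for monotypic tilings of the plane by convex p-gons when p > 6. Here normal means there exist real numbers 0 < r ≤ R such that every tile contains some closed Euclidean disk of radius r and is contained in some closed Euclidean disk of radius R. -/

import Mathlib

open Set

noncomputable section

abbrev Euc (d : ℕ) := EuclideanSpace ℝ (Fin d)

/-- A tiling of `ℝ^d`: a family of closed sets covering the space with pairwise
disjoint interiors. -/
def IsTiling {d : ℕ} (𝒯 : Set (Set (Euc d))) : Prop :=
  (∀ T ∈ 𝒯, IsClosed T) ∧ ⋃₀ 𝒯 = Set.univ ∧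
    𝒯.Pairwise fun S T => interior S ∩ interior T = ∅

/-- Local finiteness: every compact set meets only finitely many tiles. -/
def LocallyFiniteTiling {d : ℕ} (𝒯 : Set (Set (Euc d))) : Prop :=
  ∀ K : Set (Euc d), IsCompact K → {T ∈ 𝒯 | (T ∩ K).Nonempty}.Finite

/-- `S` is an isometric copy of `T`. -/
def IsometricCopy {d : ℕ} (S T : Set (Euc d)) : Prop :=
  ∃ g : Euc d ≃ᵢ Euc d, g '' T = S

/-- A monohedral tiling with prototile `T`. -/
def Monohedral {d : ℕ} (𝒯 : Set (Set (Euc d))) (T : Set (Euc d)) : Prop :=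
  ∀ S ∈ 𝒯, IsometricCopy S T

/-- A convex `d`-polytope in `ℝ^d`: convex hull of a finite set, with nonempty interior. -/
def IsConvexPolytope {d : ℕ} (P : Set (Euc d)) : Prop :=
  (∃ V : Finset (Euc d), P = convexHull ℝ (V : Set (Euc d))) ∧ (interior P).Nonempty

/-- A tiling is face-to-face if the intersection of any two distinct tiles is a
face (extreme subset), possibly empty, of each of them. -/
def FaceToFace {d : ℕ} (𝒯 : Set (Set (Euc d))) : Prop :=
  ∀ S ∈ 𝒯, ∀ T ∈ 𝒯, S ≠ T → IsExtreme ℝ S (S ∩ T) ∧ IsExtreme ℝ T (S ∩ T)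

/-- Combinatorial equivalence: an order isomorphism between the face posets
(posets of extreme subsets ordered by inclusion). -/
def CombEquiv {d e : ℕ} (P : Set (Euc d)) (Q : Set (Euc e)) : Prop :=
  Nonempty ({F : Set (Euc d) // IsExtreme ℝ P F} ≃o {F : Set (Euc e) // IsExtreme ℝ Q F})

/-- A facet: a maximal proper nonempty face. -/
def IsFacet {d : ℕ} (Q F : Set (Euc d)) : Prop :=
  IsExtreme ℝ Q F ∧ F.Nonempty ∧ F ≠ Q ∧
    ∀ G : Set (Euc d), IsExtreme ℝ Q G → G ≠ Q → F ⊆ G → G = F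


/-- A normal tiling: tiles are uniformly bounded between inradius `r` and
circumradius `R`. -/
def NormalTiling {d : ℕ} (𝒯 : Set (Set (Euc d))) : Prop :=
  ∃ r R : ℝ, 0 < r ∧ r ≤ R ∧ ∀ T ∈ 𝒯,
    (∃ c : Euc d, Metric.closedBall c r ⊆ T) ∧ (∃ c : Euc d, T ⊆ Metric.closedBall c R)

open MeasureTheory Metric

/-! ### The planar cross product -/

/-- The determinant of two plane vectors. -/
def cross (x y : Euc 2) : ℝ := x 0 * y 1 - x 1 * y 0

/-- `cross x` as a linear map. -/
def crossLin (x : Euc 2) : Euc 2 →ₗ[ℝ] ℝ where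
  toFun := cross x
  map_add' y z := by simp only [cross, PiLp.add_apply]; ring
  map_smul' c y := by
    simp only [cross, PiLp.smul_apply, smul_eq_mul, RingHom.id_apply]; ring

lemma crossLin_apply (x y : Euc 2) : crossLin x y = cross x y := rfl

lemma cross_smul_right (x y : Euc 2) (c : ℝ) : cross x (c • y) = c * cross x y :=
  (crossLin x).map_smul c y

lemma cross_swap (x y : Euc 2) : cross x y = -cross y x := by
  simp only [cross]; ring

lemma cross_neg_right (x y : Euc 2) : cross x (-y) = -cross x y :=
  (crossLin x).map_neg y

lemma cross_sub_right (x y z : Euc 2) : cross x (y - z) = cross x y - cross x z :=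
  (crossLin x).map_sub y z

lemma continuous_cross (x : Euc 2) : Continuous (cross x) :=
  (crossLin x).continuous_of_finiteDimensional

lemma exists_cross_eq_one {x : Euc 2} (hx : x ≠ 0) : ∃ y, cross x y = 1 := by
  have h : x 0 ≠ 0 ∨ x 1 ≠ 0 := by
    by_contra! h
    exact hx (by ext i; fin_cases i <;> simp [h.1, h.2])
  rcases h with h | h
  · exact ⟨!₂[0, (x 0)⁻¹], by simp [cross, h]⟩
  · exact ⟨!₂[-(x 1)⁻¹, 0], by simp [cross, h]⟩

lemma ne_zero_of_cross_ne_zero {x y : Euc 2} (h : cross x y ≠ 0) : x ≠ 0 := by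
  rintro rfl
  exact h (by simp [cross])

lemma volume_cross_eq_zero {x : Euc 2} (hx : x ≠ 0) : volume {y | cross x y = 0} = 0 := by
  obtain ⟨y, hy⟩ := exists_cross_eq_one hx
  refine Measure.addHaar_submodule volume (LinearMap.ker (crossLin x)) fun h => ?_
  have h' : y ∈ LinearMap.ker (crossLin x) := h ▸ Submodule.mem_top
  rw [LinearMap.mem_ker, crossLin_apply, hy] at h'
  exact one_ne_zero h'

/-- A point of the plane expanded in the basis `p, q`. -/
lemma cross_smul_eq (p q x : Euc 2) :
    cross p q • x = cross x q • p + cross p x • q := by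
  ext i
  fin_cases i <;>
    simp only [cross, PiLp.smul_apply, PiLp.add_apply, smul_eq_mul, Fin.isValue, Fin.zero_eta,
      Fin.mk_one] <;> ring

lemma measurableSet_cross_nonneg (p : Euc 2) : MeasurableSet {x | 0 ≤ cross p x} :=
  (isClosed_le continuous_const (continuous_cross p)).measurableSet

lemma volume_halfplane {p : Euc 2} (hp : p ≠ 0) :
    volume.real ({x | 0 ≤ cross p x} ∩ ball 0 1) = volume.real (ball (0 : Euc 2) 1) / 2 := by
  set H : Set (Euc 2) := {x | 0 ≤ cross p x} ∩ ball 0 1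
  have hm : MeasurableSet H := (measurableSet_cross_nonneg p).inter measurableSet_ball
  have hf : volume H ≠ ⊤ := measure_ne_top_of_subset inter_subset_right measure_ball_lt_top.ne
  have hneg : volume (Neg.neg ⁻¹' H) = volume H := Measure.measure_preimage_neg _ _
  have hU : H ∪ Neg.neg ⁻¹' H = ball 0 1 := by
    ext x
    simp only [H, mem_union, mem_inter_iff, mem_preimage, mem_ofPred_eq, cross_neg_right,
      mem_ball_zero_iff, norm_neg, Left.nonneg_neg_iff, ← or_and_right, le_total, true_and]
  have hd : AEDisjoint volume H (Neg.neg ⁻¹' H) := by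
    refine measure_mono_null ?_ (volume_cross_eq_zero hp)
    intro x hx
    simp only [H, mem_inter_iff, mem_preimage, mem_ofPred_eq, cross_neg_right] at hx ⊢
    linarith [hx.1.1, hx.2.1]
  have := measureReal_union₀ (hm.preimage measurable_neg).nullMeasurableSet hd hf (hneg ▸ hf)
  rw [hU] at this
  have h2 : volume.real (Neg.neg ⁻¹' H) = volume.real H := by simp only [measureReal_def, hneg]
  linarith

/-! ### Angles of convex polygons -/

/-- The cone of directions pointing from `v` into `T`. -/
def feasibleCone (T : Set (Euc 2)) (v : Euc 2) : Set (Euc 2) :=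
  ⋃ n : ℕ, {x | v + ((n : ℝ) + 1)⁻¹ • x ∈ T}

/-- The normal cone of `T` at `v`, rotated by a right angle. -/
def rotatedNormalCone (T : Set (Euc 2)) (v : Euc 2) : Set (Euc 2) :=
  {y | ∀ x ∈ T, 0 ≤ cross (x - v) y}

/-- The angle of `T` at `v`, measured as the area of a sector of the unit disk. -/
def sectorArea (T : Set (Euc 2)) (v : Euc 2) : ℝ := volume.real (feasibleCone T v ∩ ball 0 1)

/-- The exterior angle of `T` at `v`, measured as the area of a sector of the unit disk. -/
def exteriorArea (T : Set (Euc 2)) (v : Euc 2) : ℝ :=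
  volume.real (rotatedNormalCone T v ∩ ball 0 1)

lemma IsConvexPolytope.convex {d : ℕ} {T : Set (Euc d)} (hT : IsConvexPolytope T) :
    Convex ℝ T := by
  obtain ⟨⟨V, rfl⟩, -⟩ := hT
  exact convex_convexHull ℝ _

lemma IsConvexPolytope.isCompact {d : ℕ} {T : Set (Euc d)} (hT : IsConvexPolytope T) :
    IsCompact T := by
  obtain ⟨⟨V, rfl⟩, -⟩ := hT
  exact V.finite_toSet.isCompact_convexHull ℝ

lemma IsConvexPolytope.finite_extremePoints {d : ℕ} {T : Set (Euc d)}
    (hT : IsConvexPolytope T) : (extremePoints ℝ T).Finite := by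
  obtain ⟨⟨V, rfl⟩, -⟩ := hT
  exact V.finite_toSet.subset extremePoints_convexHull_subset

lemma interior_cross_level {p v : Euc 2} (hp : p ≠ 0) {T : Set (Euc 2)}
    (h : ∀ x ∈ T, cross p (x - v) = 0) : interior T = ∅ := by
  by_contra! hne
  have hpos : 0 < volume (interior T) := isOpen_interior.measure_pos _ hne
  have h0 : volume ((fun x => x + (-v)) ⁻¹' {y | cross p y = 0}) = 0 := by
    rw [measure_preimage_add_right, volume_cross_eq_zero hp]
  refine hpos.ne' (measure_mono_null (fun x hx => ?_) h0)
  simpa [sub_eq_add_neg] using h x (interior_subset hx)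

lemma exists_edge_vectors {T : Set (Euc 2)} (hT : IsConvexPolytope T) {v : Euc 2}
    (hv : v ∈ extremePoints ℝ T) :
    ∃ p q, 0 < cross p q ∧ v + p ∈ T ∧ v + q ∈ T ∧
      ∀ x ∈ T, 0 ≤ cross p (x - v) ∧ 0 ≤ cross (x - v) q := by
  classical
  obtain ⟨⟨V, rfl⟩, hint⟩ := hT
  set T := convexHull ℝ (V : Set (Euc 2)) with hTdef
  have hconv : Convex ℝ T := convex_convexHull ℝ _
  have hVT : (V : Set (Euc 2)) ⊆ T := subset_convexHull ℝ _
  have hsub : convexHull ℝ ((V.erase v : Finset _) : Set (Euc 2)) ⊆ T \ {v} := by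
    refine convexHull_min ?_ (hconv.mem_extremePoints_iff_convex_sdiff.1 hv).2
    intro x hx
    rw [Finset.mem_coe, Finset.mem_erase] at hx
    exact ⟨hVT hx.2, hx.1⟩
  obtain ⟨f, u, hfv, hfu⟩ := geometric_hahn_banach_point_closed (convex_convexHull ℝ _)
    ((V.erase v).finite_toSet.isCompact_convexHull ℝ).isClosed (fun h => (hsub h).2 rfl)
  obtain ⟨a, ha⟩ : ∃ a : Euc 2, ∀ x, f x = a 0 * x 0 + a 1 * x 1 := by
    refine ⟨!₂[f (EuclideanSpace.single 0 1), f (EuclideanSpace.single 1 1)], fun x => ?_⟩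
    have hx : x = x 0 • EuclideanSpace.single 0 1 + x 1 • EuclideanSpace.single 1 1 := by
      ext i; fin_cases i <;> simp
    conv_lhs => rw [hx]
    simp only [map_add, map_smul, smul_eq_mul]
    simp [mul_comm]
  have hpos : ∀ w ∈ V.erase v, 0 < f (w - v) := fun w hw => by
    rw [map_sub, sub_pos]
    exact hfv.trans (hfu w (subset_convexHull ℝ _ (Finset.mem_coe.2 hw)))
  have hne : (V.erase v).Nonempty := by
    by_contra! h
    have hVv : (V : Set (Euc 2)) ⊆ {v} := fun x hx => by
      by_contra hxv
      exact Finset.notMem_empty x (h ▸ Finset.mem_erase.2 ⟨hxv, hx⟩)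
    have : T ⊆ {v} := convexHull_min hVv (convex_singleton v)
    have h0 := hint.mono (interior_mono this)
    rw [interior_singleton] at h0
    exact not_nonempty_empty h0
  set s : Euc 2 → ℝ := fun w => cross a (w - v) / f (w - v) with hs
  obtain ⟨p, hp, hpmin⟩ := Finset.exists_min_image _ s hne
  obtain ⟨q, hq, hqmax⟩ := Finset.exists_max_image _ s hne
  have hasq : 0 < a 0 ^ 2 + a 1 ^ 2 := by
    by_contra! h
    have h0 : a 0 = 0 := by nlinarith [sq_nonneg (a 0), sq_nonneg (a 1)]
    have h1 : a 1 = 0 := by nlinarith [sq_nonneg (a 0), sq_nonneg (a 1)]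
    have := hpos p hp
    rw [ha, h0, h1] at this
    simp at this
  have key : ∀ w ∈ V.erase v, ∀ z ∈ V.erase v, s w ≤ s z → 0 ≤ cross (w - v) (z - v) := by
    intro w hw z hz h
    rw [hs, div_le_div_iff₀ (hpos w hw) (hpos z hz)] at h
    have hid : (a 0 ^ 2 + a 1 ^ 2) * cross (w - v) (z - v) =
        cross a (z - v) * f (w - v) - cross a (w - v) * f (z - v) := by
      rw [ha, ha]; simp only [cross]; ring
    by_contra! hlt
    nlinarith [mul_neg_of_pos_of_neg hasq hlt]
  have hVe : ∀ x ∈ V, x = v ∨ x ∈ V.erase v := fun x hx => by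
    by_cases h : x = v
    · exact Or.inl h
    · exact Or.inr (Finset.mem_erase.2 ⟨h, hx⟩)
  have hTp : ∀ x ∈ T, 0 ≤ cross (p - v) (x - v) := by
    have hc : Convex ℝ {x | cross (p - v) v ≤ crossLin (p - v) x} :=
      convex_halfSpace_ge (crossLin (p - v)).isLinear _
    intro x hx
    have := convexHull_min (t := {x | cross (p - v) v ≤ crossLin (p - v) x}) ?_ hc hx
    · rw [cross_sub_right]
      exact sub_nonneg.2 this
    · intro y hy
      rw [mem_ofPred_eq, crossLin_apply, ← sub_nonneg, ← cross_sub_right]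
      rcases hVe y hy with rfl | hy
      · simp [cross]
      · exact key p hp y hy (hpmin y hy)
  have hTq : ∀ x ∈ T, 0 ≤ cross (x - v) (q - v) := by
    have hc : Convex ℝ {x | crossLin (q - v) x ≤ cross (q - v) v} :=
      convex_halfSpace_le (crossLin (q - v)).isLinear _
    intro x hx
    have := convexHull_min (t := {x | crossLin (q - v) x ≤ cross (q - v) v}) ?_ hc hx
    · rw [cross_swap, cross_sub_right, neg_sub]
      exact sub_nonneg.2 this
    · intro y hy
      rw [mem_ofPred_eq, crossLin_apply, ← sub_nonneg, ← neg_sub, ← cross_sub_right, ← cross_swap]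
      rcases hVe y hy with rfl | hy
      · simp [cross]
      · exact key y hy q hq (hqmax y hy)
  have hpT : p ∈ T := hVT (Finset.mem_of_mem_erase hp)
  have hqT : q ∈ T := hVT (Finset.mem_of_mem_erase hq)
  refine ⟨p - v, q - v, lt_of_le_of_ne (hTp q hqT) fun h0 => ?_, by simpa, by simpa,
    fun x hx => ⟨hTp x hx, hTq x hx⟩⟩
  have hp0 : p - v ≠ 0 := fun h => by simpa [h] using hpos p hp
  refine hint.ne_empty (interior_cross_level (v := v) hp0 fun x hx => ?_)
  -- all of `T` lies on the line through `v` and `p`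
  have e1 : f (p - v) * cross (x - v) (q - v) + f (q - v) * cross (p - v) (x - v) =
      f (x - v) * cross (p - v) (q - v) := by
    rw [ha, ha, ha]; simp only [cross]; ring
  rw [← h0, mul_zero] at e1
  have := mul_nonneg (hpos p hp).le (hTq x hx)
  have h3 := mul_nonneg (hpos q hq).le (hTp x hx)
  have h4 : f (q - v) * cross (p - v) (x - v) = 0 := by linarith
  exact (mul_eq_zero.1 h4).resolve_left (hpos q hq).ne'

lemma mem_feasibleCone_iff {T : Set (Euc 2)} (hT : Convex ℝ T) {v p q : Euc 2} (hv : v ∈ T)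
    (hpq : 0 < cross p q) (hp : v + p ∈ T) (hq : v + q ∈ T)
    (h : ∀ x ∈ T, 0 ≤ cross p (x - v) ∧ 0 ≤ cross (x - v) q) (x : Euc 2) :
    x ∈ feasibleCone T v ↔ 0 ≤ cross p x ∧ 0 ≤ cross x q := by
  simp only [feasibleCone, mem_iUnion, mem_ofPred_eq]
  constructor
  · rintro ⟨n, hn⟩
    obtain ⟨h1, h2⟩ := h _ hn
    have hn0 : 0 < ((n : ℝ) + 1)⁻¹ := by positivity
    rw [add_sub_cancel_left, cross_smul_right] at h1
    rw [add_sub_cancel_left, cross_swap, cross_smul_right, ← mul_neg, ← cross_swap] at h2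
    exact ⟨nonneg_of_mul_nonneg_right h1 hn0, nonneg_of_mul_nonneg_right h2 hn0⟩
  · rintro ⟨h1, h2⟩
    set a := cross x q / cross p q
    set b := cross p x / cross p q
    have ha : 0 ≤ a := by positivity
    have hb : 0 ≤ b := by positivity
    have hx : x = a • p + b • q := by
      have := cross_smul_eq p q x
      rw [← eq_inv_smul_iff₀ hpq.ne', smul_add, smul_smul, smul_smul] at this
      rw [this]
      simp only [a, b, div_eq_inv_mul]
    obtain ⟨n, hn⟩ := exists_nat_ge (a + b)
    refine ⟨n, ?_⟩
    set t := ((n : ℝ) + 1)⁻¹ with ht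
    have ht0 : 0 < t := by positivity
    have ht1 : t * (a + b) ≤ 1 := by
      rw [ht, inv_mul_le_iff₀ (by positivity)]; linarith
    have e : v + t • x = (1 - t * (a + b)) • v + (t * a) • (v + p) + (t * b) • (v + q) := by
      rw [hx]; module
    rw [e]
    have := hT.sum_mem (t := Finset.univ) (w := ![1 - t * (a + b), t * a, t * b])
      (z := ![v, v + p, v + q]) ?_ ?_ ?_
    · rwa [Fin.sum_univ_three] at this
    · intro i _
      fin_cases i
      exacts [sub_nonneg.2 ht1, mul_nonneg ht0.le ha, mul_nonneg ht0.le hb]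
    · simp only [Fin.sum_univ_three, Matrix.cons_val]
      ring
    · intro i _
      fin_cases i
      exacts [hv, hp, hq]

lemma rotatedNormalCone_eq {T : Set (Euc 2)} {v p q : Euc 2}
    (hpq : 0 < cross p q) (hp : v + p ∈ T) (hq : v + q ∈ T)
    (h : ∀ x ∈ T, 0 ≤ cross p (x - v) ∧ 0 ≤ cross (x - v) q) :
    rotatedNormalCone T v = {y | 0 ≤ cross p y ∧ 0 ≤ cross q y} := by
  ext y
  refine ⟨fun hy => ⟨by simpa using hy _ hp, by simpa using hy _ hq⟩, fun ⟨h1, h2⟩ x hx => ?_⟩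
  obtain ⟨h3, h4⟩ := h x hx
  have e : cross p q * cross (x - v) y =
      cross (x - v) q * cross p y + cross p (x - v) * cross q y := by
    simp only [cross]; ring
  exact nonneg_of_mul_nonneg_right (e ▸ by positivity) hpq

lemma measurableSet_feasibleCone {T : Set (Euc 2)} (hT : IsClosed T) (v : Euc 2) :
    MeasurableSet (feasibleCone T v) :=
  MeasurableSet.iUnion fun n => (hT.preimage (by fun_prop)).measurableSet

lemma isClosed_rotatedNormalCone (T : Set (Euc 2)) (v : Euc 2) :
    IsClosed (rotatedNormalCone T v) := by
  simp only [rotatedNormalCone, ofPred_forall]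
  exact isClosed_iInter fun x => isClosed_iInter fun _ =>
    isClosed_le continuous_const (continuous_cross _)

lemma volume_inter_ball_ne_top (S : Set (Euc 2)) : volume (S ∩ ball 0 1) ≠ ⊤ :=
  measure_ne_top_of_subset inter_subset_right measure_ball_lt_top.ne

/-- Interior and exterior angle add up to a straight angle. -/
lemma sectorArea_add_exteriorArea {T : Set (Euc 2)} (hT : IsConvexPolytope T) {v : Euc 2}
    (hv : v ∈ extremePoints ℝ T) :
    sectorArea T v + exteriorArea T v = volume.real (ball (0 : Euc 2) 1) / 2 := by
  obtain ⟨p, q, hpq, hp, hq, h⟩ := exists_edge_vectors hT hv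
  have hp0 : p ≠ 0 := ne_zero_of_cross_ne_zero hpq.ne'
  have hq0 : q ≠ 0 := ne_zero_of_cross_ne_zero (y := p) (by rw [cross_swap]; simpa using hpq.ne')
  have hC := mem_feasibleCone_iff hT.convex hv.1 hpq hp hq h
  have hN := rotatedNormalCone_eq hpq hp hq h
  rw [sectorArea, exteriorArea, ← volume_halfplane hp0, ← measureReal_union₀]
  · congr 1
    ext x
    simp only [mem_union, mem_inter_iff, hC, hN, mem_ofPred_eq, ← or_and_right, ← and_or_left,
      cross_swap x q, Left.nonneg_neg_iff, le_total, and_true]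
  · exact ((isClosed_rotatedNormalCone T v).measurableSet.inter
      measurableSet_ball).nullMeasurableSet
  · refine measure_mono_null ?_ (volume_cross_eq_zero hq0)
    rintro x ⟨⟨hx, -⟩, hx', -⟩
    rw [hC, cross_swap x q] at hx
    rw [hN] at hx'
    exact le_antisymm (by linarith [hx.2]) hx'.2

lemma exteriorArea_pos {T : Set (Euc 2)} (hT : IsConvexPolytope T) {v : Euc 2}
    (hv : v ∈ extremePoints ℝ T) : 0 < exteriorArea T v := by
  obtain ⟨p, q, hpq, hp, hq, h⟩ := exists_edge_vectors hT hv
  have hN := rotatedNormalCone_eq hpq hp hq h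
  have hopen : IsOpen ({y | 0 < cross p y ∧ 0 < cross q y} ∩ ball 0 1) :=
    ((isOpen_lt continuous_const (continuous_cross p)).inter
      (isOpen_lt continuous_const (continuous_cross q))).inter isOpen_ball
  have hne : ({y | 0 < cross p y ∧ 0 < cross q y} ∩ ball 0 1).Nonempty := by
    refine ⟨(‖q - p‖ + 1)⁻¹ • (q - p), ⟨?_, ?_⟩, ?_⟩
    · rw [cross_smul_right, cross_sub_right, show cross p p = 0 by simp only [cross]; ring]
      simp only [sub_zero]; positivity
    · rw [cross_smul_right, cross_sub_right, show cross q q = 0 by simp only [cross]; ring,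
        cross_swap q p]
      simp only [zero_sub, neg_neg]; positivity
    · rw [mem_ball_zero_iff, norm_smul, norm_inv, Real.norm_of_nonneg (by positivity),
        inv_mul_lt_iff₀ (by positivity)]
      linarith
  refine ENNReal.toReal_pos (ne_of_gt ?_) (volume_inter_ball_ne_top _)
  refine (hopen.measure_pos volume hne).trans_le (measure_mono (inter_subset_inter_left _ ?_))
  rw [hN]
  exact fun x hx => ⟨hx.1.le, hx.2.le⟩

lemma sectorArea_lt {T : Set (Euc 2)} (hT : IsConvexPolytope T) {v : Euc 2}
    (hv : v ∈ extremePoints ℝ T) : sectorArea T v < volume.real (ball (0 : Euc 2) 1) / 2 := by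
  linarith [sectorArea_add_exteriorArea hT hv, exteriorArea_pos hT hv]

/-- The exterior angles of a convex polygon add up to a full turn. -/
lemma sum_exteriorArea {T : Set (Euc 2)} (hT : IsConvexPolytope T) :
    ∑ v ∈ hT.finite_extremePoints.toFinset, exteriorArea T v =
      volume.real (ball (0 : Euc 2) 1) := by
  simp only [exteriorArea]
  rw [← measureReal_biUnion_finset₀]
  · congr 1
    refine subset_antisymm (iUnion₂_subset fun v _ => inter_subset_right) fun y hy => ?_
    let f : StrongDual ℝ (Euc 2) := LinearMap.toContinuousLinearMap (crossLin y)
    have hexp : IsExposed ℝ T (f.toExposed T) := ContinuousLinearMap.toExposed.isExposed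
    obtain ⟨x, hx, hmax⟩ := hT.isCompact.exists_isMaxOn
      (hT.2.mono interior_subset) f.continuous.continuousOn
    obtain ⟨v, hv⟩ := (hexp.isCompact hT.isCompact).extremePoints_nonempty
      ⟨x, hx, fun z hz => hmax hz⟩
    have hvT := hexp.isExtreme.extremePoints_subset_extremePoints hv
    refine mem_iUnion₂.2 ⟨v, by simpa using hvT, fun z hz => ?_, hy⟩
    have hz' : cross y z ≤ cross y v := hv.1.2 z hz
    rw [cross_swap, cross_sub_right]
    linarith
  · intro v _ w _ hvw
    refine measure_mono_null ?_ (volume_cross_eq_zero (sub_ne_zero.2 hvw))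
    rintro y ⟨⟨h1, -⟩, h2, -⟩
    rename_i hv hw
    rw [Finset.mem_coe, Finite.mem_toFinset] at hv hw
    have e1 := h1 w hw.1
    have e2 := h2 v hv.1
    rw [← neg_sub, cross_swap, cross_neg_right, neg_neg, cross_swap] at e1
    exact le_antisymm (by linarith) e2
  · exact fun v _ => ((isClosed_rotatedNormalCone T v).measurableSet.inter
      measurableSet_ball).nullMeasurableSet

/-- The angle sum of a convex polygon. -/
lemma sum_sectorArea {T : Set (Euc 2)} (hT : IsConvexPolytope T) :
    ∑ v ∈ hT.finite_extremePoints.toFinset, sectorArea T v =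
      (((extremePoints ℝ T).ncard : ℝ) / 2 - 1) * volume.real (ball (0 : Euc 2) 1) := by
  have h : ∀ v ∈ hT.finite_extremePoints.toFinset,
      sectorArea T v = volume.real (ball (0 : Euc 2) 1) / 2 - exteriorArea T v := fun v hv => by
    linarith [sectorArea_add_exteriorArea hT ((Finite.mem_toFinset _).1 hv)]
  rw [Finset.sum_congr rfl h, Finset.sum_sub_distrib, sum_exteriorArea hT, Finset.sum_const,
    ncard_eq_toFinset_card _ hT.finite_extremePoints, nsmul_eq_mul]
  ring

/-! ### Angles in tilings -/

lemma volume_inter_eq_zero {S T : Set (Euc 2)} (hS : IsConvexPolytope S)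
    (hT : IsConvexPolytope T) (h : interior S ∩ interior T = ∅) : volume (S ∩ T) = 0 := by
  refine measure_mono_null ?_ ((hS.convex.inter hT.convex).addHaar_frontier volume)
  rw [frontier, interior_inter, h, sdiff_empty]
  exact subset_closure

lemma Convex.add_inv_smul_mem {T : Set (Euc 2)} (hT : Convex ℝ T) {v x : Euc 2} (hv : v ∈ T)
    {m n : ℕ} (hmn : m ≤ n) (h : v + ((m : ℝ) + 1)⁻¹ • x ∈ T) :
    v + ((n : ℝ) + 1)⁻¹ • x ∈ T := by
  have hmn' : (m : ℝ) ≤ n := by exact_mod_cast hmn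
  have := hT.add_smul_mem hv h (t := ((m : ℝ) + 1) / (n + 1))
    ⟨by positivity, div_le_one_of_le₀ (by linarith) (by positivity)⟩
  rwa [smul_smul, div_mul_eq_mul_div, mul_inv_cancel₀ (by positivity), one_div] at this

lemma volume_feasibleCone_inter_eq_zero {S T : Set (Euc 2)} (hS : Convex ℝ S)
    (hT : Convex ℝ T) {v : Euc 2} (hvS : v ∈ S) (hvT : v ∈ T) (h : volume (S ∩ T) = 0) :
    volume (feasibleCone S v ∩ feasibleCone T v) = 0 := by
  have hsub : feasibleCone S v ∩ feasibleCone T v ⊆ feasibleCone (S ∩ T) v := by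
    rintro x ⟨hx, hx'⟩
    obtain ⟨m, hm⟩ := mem_iUnion.1 hx
    obtain ⟨n, hn⟩ := mem_iUnion.1 hx'
    exact mem_iUnion.2 ⟨max m n, hS.add_inv_smul_mem hvS (le_max_left _ _) hm,
      hT.add_inv_smul_mem hvT (le_max_right _ _) hn⟩
  refine measure_mono_null hsub (measure_iUnion_null fun n => ?_)
  have e : {x | v + ((n : ℝ) + 1)⁻¹ • x ∈ S ∩ T} =
      (fun x => ((n : ℝ) + 1)⁻¹ • x) ⁻¹' ((fun x => v + x) ⁻¹' (S ∩ T)) := rfl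
  rw [e, Measure.addHaar_preimage_smul _ (by positivity), measure_preimage_add, h, mul_zero]

lemma LocallyFiniteTiling.finite_tiles_at {d : ℕ} {𝒯 : Set (Set (Euc d))}
    (h : LocallyFiniteTiling 𝒯) (v : Euc d) : {T ∈ 𝒯 | v ∈ T}.Finite := by
  simpa using h {v} isCompact_singleton

/-- The angles of the tiles at a point add up to a full turn. -/
lemma sum_sectorArea_tiles_at {𝒯 : Set (Set (Euc 2))} (h𝒯 : IsTiling 𝒯)
    (hlf : LocallyFiniteTiling 𝒯) (hpoly : ∀ T ∈ 𝒯, IsConvexPolytope T) (v : Euc 2) :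
    ∑ T ∈ (hlf.finite_tiles_at v).toFinset, sectorArea T v =
      volume.real (ball (0 : Euc 2) 1) := by
  simp only [sectorArea]
  rw [← measureReal_biUnion_finset₀]
  · congr 1
    refine subset_antisymm (iUnion₂_subset fun v _ => inter_subset_right) fun x hx => ?_
    set F := {T ∈ 𝒯 | (T ∩ closedBall v 1).Nonempty}
    have hF : F.Finite := hlf _ (isCompact_closedBall v 1)
    have hlim : Filter.Tendsto (fun n : ℕ => v + ((n : ℝ) + 1)⁻¹ • x) Filter.atTop (nhds v) := by
      have h0 : Filter.Tendsto (fun n : ℕ => ((n : ℝ) + 1)⁻¹) Filter.atTop (nhds 0) := by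
        simpa only [one_div] using tendsto_one_div_add_atTop_nhds_zero_nat (𝕜 := ℝ)
      simpa using (h0.smul_const x).const_add v
    have hev : ∀ᶠ y in nhds v, ∀ T ∈ F, y ∈ T → v ∈ T := by
      refine (Filter.eventually_all_finite hF).2 fun T hT => ?_
      by_cases hv : v ∈ T
      · exact Filter.Eventually.of_forall fun _ _ => hv
      · filter_upwards [(h𝒯.1 T hT.1).isOpen_compl.mem_nhds hv] with y hy hy'
        exact absurd hy' hy
    obtain ⟨n, hn, hball⟩ := (hlim.eventually (hev.and (closedBall_mem_nhds v one_pos))).exists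
    obtain ⟨T, hT, hxT⟩ : v + ((n : ℝ) + 1)⁻¹ • x ∈ ⋃₀ 𝒯 := h𝒯.2.1 ▸ mem_univ _
    refine mem_iUnion₂.2 ⟨T, ?_, mem_iUnion.2 ⟨n, hxT⟩, hx⟩
    exact (Finite.mem_toFinset _).2 ⟨hT, hn T ⟨hT, _, hxT, hball⟩ hxT⟩
  · intro S hS T hT hST
    rw [Finset.mem_coe, Finite.mem_toFinset] at hS hT
    refine measure_mono_null (inter_subset_inter inter_subset_left inter_subset_left)
      (volume_feasibleCone_inter_eq_zero (hpoly S hS.1).convex (hpoly T hT.1).convex hS.2 hT.2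
        (volume_inter_eq_zero (hpoly S hS.1) (hpoly T hT.1) (h𝒯.2.2 hS.1 hT.1 hST)))
  · intro T hT
    rw [Finite.mem_toFinset] at hT
    exact ((measurableSet_feasibleCone (h𝒯.1 T hT.1) v).inter
      measurableSet_ball).nullMeasurableSet

lemma FaceToFace.mem_extremePoints {d : ℕ} {𝒯 : Set (Set (Euc d))} (h : FaceToFace 𝒯)
    {S T : Set (Euc d)} (hS : S ∈ 𝒯) (hT : T ∈ 𝒯) {v : Euc d} (hv : v ∈ extremePoints ℝ S)
    (hvT : v ∈ T) : v ∈ extremePoints ℝ T := by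
  rcases eq_or_ne S T with rfl | hST
  · exact hv
  · exact (h S hS T hT hST).2.extremePoints_subset_extremePoints
      (inter_extremePoints_subset_extremePoints_of_subset inter_subset_left ⟨⟨hv.1, hvT⟩, hv⟩)

lemma volume_unit_ball_pos : 0 < volume.real (ball (0 : Euc 2) 1) :=
  ENNReal.toReal_pos (measure_ball_pos volume _ one_pos).ne' measure_ball_lt_top.ne

/-- At least three tiles meet at a vertex of a tiling by convex polygons. -/
lemma three_le_card_tiles_at {𝒯 : Set (Set (Euc 2))} (h𝒯 : IsTiling 𝒯)
    (hlf : LocallyFiniteTiling 𝒯) (hff : FaceToFace 𝒯)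
    (hpoly : ∀ T ∈ 𝒯, IsConvexPolytope T) {S : Set (Euc 2)} (hS : S ∈ 𝒯) {v : Euc 2}
    (hv : v ∈ extremePoints ℝ S) : 3 ≤ (hlf.finite_tiles_at v).toFinset.card := by
  have hlt := Finset.sum_lt_sum_of_nonempty (s := (hlf.finite_tiles_at v).toFinset)
    ⟨S, (Finite.mem_toFinset _).2 ⟨hS, hv.1⟩⟩ fun T hT => by
      rw [Finite.mem_toFinset] at hT
      exact sectorArea_lt (hpoly T hT.1) (hff.mem_extremePoints hS hT.1 hv hT.2)
  rw [sum_sectorArea_tiles_at h𝒯 hlf hpoly, Finset.sum_const, nsmul_eq_mul] at hlt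
  have h2 : (2 : ℝ) < (hlf.finite_tiles_at v).toFinset.card := by
    by_contra! h
    nlinarith [volume_unit_ball_pos]
  exact_mod_cast h2

open Classical in
/-- The tiles of `𝒜` having a vertex that lies on a tile of `𝒯` outside `𝒜`. -/
def boundaryTiles (𝒯 : Set (Set (Euc 2))) (𝒜 : Finset (Set (Euc 2))) :
    Finset (Set (Euc 2)) :=
  {T ∈ 𝒜 | ∃ v ∈ extremePoints ℝ T, ∃ S ∈ 𝒯, v ∈ S ∧ S ∉ 𝒜}

lemma mem_boundaryTiles {𝒯 : Set (Set (Euc 2))} {𝒜 : Finset (Set (Euc 2))}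
    {T : Set (Euc 2)} : T ∈ boundaryTiles 𝒯 𝒜 ↔
      T ∈ 𝒜 ∧ ∃ v ∈ extremePoints ℝ T, ∃ S ∈ 𝒯, v ∈ S ∧ S ∉ 𝒜 := by
  classical
  exact Finset.mem_filter

/-- A finite patch of `p`-gons has a linear proportion of boundary tiles when `6 < p`. -/
lemma card_mul_le_card_boundaryTiles {𝒯 : Set (Set (Euc 2))} (h𝒯 : IsTiling 𝒯)
    (hlf : LocallyFiniteTiling 𝒯) (hff : FaceToFace 𝒯)
    (hpoly : ∀ T ∈ 𝒯, IsConvexPolytope T) {p : ℕ}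
    (hp : ∀ T ∈ 𝒯, (extremePoints ℝ T).ncard = p) (𝒜 : Finset (Set (Euc 2)))
    (h𝒜 : ∀ T ∈ 𝒜, T ∈ 𝒯) :
    ((p : ℝ) - 6) * 𝒜.card ≤ p * (boundaryTiles 𝒯 𝒜).card := by
  classical
  set β := volume.real (ball (0 : Euc 2) 1) with hβ
  have hβ0 : 0 < β := volume_unit_ball_pos
  choose! E hE using show ∀ T ∈ 𝒯, ∃ E : Finset (Euc 2), ∀ v, v ∈ E ↔ v ∈ extremePoints ℝ T from
    fun T hT => ⟨(hpoly T hT).finite_extremePoints.toFinset, fun v => Finite.mem_toFinset _⟩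
  have hEeq : ∀ T (hT : T ∈ 𝒯), E T = (hpoly T hT).finite_extremePoints.toFinset :=
    fun T hT => by ext v; rw [hE T hT, Finite.mem_toFinset]
  have hcard : ∀ T ∈ 𝒯, (E T).card = p := fun T hT => by
    rw [hEeq T hT, ← ncard_eq_toFinset_card _ (hpoly T hT).finite_extremePoints, hp T hT]
  have hswap : ∀ g : Set (Euc 2) → Euc 2 → ℝ, ∑ T ∈ 𝒜, ∑ v ∈ E T, g T v =
      ∑ v ∈ 𝒜.biUnion E, ∑ T ∈ 𝒜 with v ∈ E T, g T v := fun g => by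
    refine Finset.sum_comm' fun T v => ?_
    simp only [Finset.mem_filter, Finset.mem_biUnion]
    exact ⟨fun h => ⟨h, T, h⟩, fun h => h.1⟩
  have hbound : ∑ T ∈ 𝒜, ∑ v ∈ E T, (sectorArea T v - β / 3) ≤
      ∑ T ∈ 𝒜, ∑ v ∈ E T, (if T ∈ boundaryTiles 𝒯 𝒜 then β / 6 else 0) := by
    rw [hswap, hswap]
    refine Finset.sum_le_sum fun v hv => ?_
    obtain ⟨T₀, hT₀, hv₀⟩ := Finset.mem_biUnion.1 hv
    rw [hE T₀ (h𝒜 T₀ hT₀)] at hv₀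
    by_cases hgood : ∀ S ∈ 𝒯, v ∈ S → S ∈ 𝒜
    · have hfilter : 𝒜.filter (fun T => v ∈ E T) = (hlf.finite_tiles_at v).toFinset := by
        ext T
        rw [Finset.mem_filter, Finite.mem_toFinset]
        refine ⟨fun h => ⟨h𝒜 T h.1, ((hE T (h𝒜 T h.1) v).1 h.2).1⟩, fun h => ⟨hgood T h.1 h.2, ?_⟩⟩
        exact (hE T h.1 v).2 (hff.mem_extremePoints (h𝒜 T₀ hT₀) h.1 hv₀ h.2)
      have h3 := three_le_card_tiles_at h𝒯 hlf hff hpoly (h𝒜 T₀ hT₀) hv₀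
      have h3' : (3 : ℝ) ≤ (hlf.finite_tiles_at v).toFinset.card := by exact_mod_cast h3
      rw [hfilter, Finset.sum_sub_distrib, sum_sectorArea_tiles_at h𝒯 hlf hpoly,
        Finset.sum_const, nsmul_eq_mul, ← hβ]
      refine le_trans ?_ (Finset.sum_nonneg fun T _ => by split_ifs <;> positivity)
      nlinarith
    · push Not at hgood
      refine Finset.sum_le_sum fun T hT => ?_
      rw [Finset.mem_filter] at hT
      have hvT := (hE T (h𝒜 T hT.1) v).1 hT.2
      rw [if_pos (mem_boundaryTiles.2 ⟨hT.1, v, hvT, hgood⟩)]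
      linarith [sectorArea_lt (hpoly T (h𝒜 T hT.1)) hvT]
  have hleft : ∑ T ∈ 𝒜, ∑ v ∈ E T, (sectorArea T v - β / 3) =
      𝒜.card * ((p / 2 - 1) * β - p * (β / 3)) := by
    rw [← nsmul_eq_mul, ← Finset.sum_const]
    refine Finset.sum_congr rfl fun T hT => ?_
    rw [Finset.sum_sub_distrib, Finset.sum_const, hcard T (h𝒜 T hT), nsmul_eq_mul,
      hEeq T (h𝒜 T hT), sum_sectorArea (hpoly T (h𝒜 T hT)), hp T (h𝒜 T hT)]
  have hright : ∑ T ∈ 𝒜, ∑ v ∈ E T, (if T ∈ boundaryTiles 𝒯 𝒜 then β / 6 else 0) =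
      (boundaryTiles 𝒯 𝒜).card * (p * (β / 6)) := by
    have : ∀ T ∈ 𝒜, ∑ v ∈ E T, (if T ∈ boundaryTiles 𝒯 𝒜 then β / 6 else 0) =
        if T ∈ boundaryTiles 𝒯 𝒜 then p * (β / 6) else 0 := fun T hT => by
      rw [Finset.sum_const, hcard T (h𝒜 T hT), nsmul_eq_mul, mul_ite, mul_zero]
    rw [Finset.sum_congr rfl this, ← Finset.sum_filter, Finset.sum_const, nsmul_eq_mul,
      Finset.filter_mem_eq_inter, Finset.inter_eq_right.2 fun T hT => (mem_boundaryTiles.1 hT).1]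
  rw [hleft, hright] at hbound
  refine le_of_mul_le_mul_right ?_ (show 0 < β / 6 by positivity)
  linarith

/-- The number of tiles meeting a ball grows at most like the area of a larger ball. -/
lemma card_mul_sq_le {𝒯 : Set (Set (Euc 2))} (h𝒯 : IsTiling 𝒯)
    (hpoly : ∀ T ∈ 𝒯, IsConvexPolytope T) {r ρ : ℝ} (hr : 0 < r) (hρ : 0 ≤ ρ)
    (hin : ∀ T ∈ 𝒯, ∃ c : Euc 2, closedBall c r ⊆ T) (𝒜 : Finset (Set (Euc 2)))
    (h𝒜 : ∀ T ∈ 𝒜, T ∈ 𝒯 ∧ T ⊆ closedBall 0 ρ) : 𝒜.card * r ^ 2 ≤ ρ ^ 2 := by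
  have hfin : ∀ T ∈ 𝒜, volume T ≠ ⊤ := fun T hT => (hpoly T (h𝒜 T hT).1).isCompact.measure_ne_top
  have hsum : volume.real (⋃ T ∈ 𝒜, T) = ∑ T ∈ 𝒜, volume.real T :=
    measureReal_biUnion_finset₀ (fun S hS T hT hST => volume_inter_eq_zero
        (hpoly S (h𝒜 S hS).1) (hpoly T (h𝒜 T hT).1) (h𝒯.2.2 (h𝒜 S hS).1 (h𝒜 T hT).1 hST))
      (fun T hT => (h𝒯.1 T (h𝒜 T hT).1).measurableSet.nullMeasurableSet) hfin
  have hle : volume.real (⋃ T ∈ 𝒜, T) ≤ volume.real (closedBall (0 : Euc 2) ρ) :=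
    measureReal_mono (iUnion₂_subset fun T hT => (h𝒜 T hT).2)
      (isCompact_closedBall _ _).measure_ne_top
  have hge : 𝒜.card • (r ^ 2 * volume.real (ball (0 : Euc 2) 1)) ≤ ∑ T ∈ 𝒜, volume.real T := by
    refine Finset.card_nsmul_le_sum _ _ _ fun T hT => ?_
    obtain ⟨c, hc⟩ := hin T (h𝒜 T hT).1
    have := measureReal_mono hc (hfin T hT)
    rwa [Measure.addHaar_real_closedBall _ _ hr.le, finrank_euclideanSpace_fin] at this
  rw [Measure.addHaar_real_closedBall _ _ hρ, finrank_euclideanSpace_fin] at hle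
  rw [nsmul_eq_mul] at hge
  refine le_of_mul_le_mul_right ?_ volume_unit_ball_pos
  linarith

lemma not_le_sq_of_geometric_growth {g : ℕ → ℝ} {q K : ℝ} (hq : 1 < q) (h0 : 1 ≤ g 0)
    (hg : ∀ n, q * g n ≤ g (n + 1)) : ¬ ∀ n : ℕ, g n ≤ K * ((n : ℝ) + 1) ^ 2 := by
  intro hK
  have hpow : ∀ n, q ^ n ≤ g n := fun n => by
    induction n with
    | zero => simpa using h0
    | succ n ih =>
      rw [pow_succ']
      exact (mul_le_mul_of_nonneg_left ih (by linarith)).trans (hg n)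
  have hlim := ((tendsto_pow_const_div_const_pow_of_one_lt 2 hq).comp
    (Filter.tendsto_add_atTop_nat 1)).const_mul (K * q)
  rw [mul_zero] at hlim
  obtain ⟨n, hn⟩ := (hlim.eventually (gt_mem_nhds one_pos)).exists
  have hqn : 0 < q ^ n := by positivity
  simp only [Function.comp_apply, Nat.cast_add, Nat.cast_one, pow_succ q n] at hn
  have e : K * q * (((n : ℝ) + 1) ^ 2 / (q ^ n * q)) = K * ((n : ℝ) + 1) ^ 2 / q ^ n := by
    field_simp
  rw [e, div_lt_one hqn] at hn
  linarith [hpow n, hK n]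

/-- for `p ≥ 7` there is no normal locally finite face-to-face tiling of
the plane by convex `p`-gons. -/
theorem no_normal_tiling_by_p_gons (p : ℕ) (hp : 7 ≤ p) :
    ¬ ∃ 𝒯 : Set (Set (Euc 2)), IsTiling 𝒯 ∧ LocallyFiniteTiling 𝒯 ∧ FaceToFace 𝒯 ∧
        NormalTiling 𝒯 ∧
        ∀ T ∈ 𝒯, IsConvexPolytope T ∧ (Set.extremePoints ℝ T).ncard = p := by
  rintro ⟨𝒯, h𝒯, hlf, hff, ⟨r, R, hr, hrR, hnormal⟩, htiles⟩
  have hpoly : ∀ T ∈ 𝒯, IsConvexPolytope T := fun T hT => (htiles T hT).1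
  have hR : 0 < R := hr.trans_le hrR
  have hdiam : ∀ T ∈ 𝒯, ∀ x ∈ T, ∀ y ∈ T, ‖x‖ ≤ ‖y‖ + 2 * R := fun T hT x hx y hy => by
    obtain ⟨c, hc⟩ := (hnormal T hT).2
    have h1 := mem_closedBall.1 (hc hx)
    have h2 := mem_closedBall.1 (hc hy)
    have h3 := dist_triangle_right x y c
    have h4 := norm_le_norm_add_norm_sub' x y
    rw [dist_eq_norm] at h3
    linarith
  let 𝒜 : ℕ → Finset (Set (Euc 2)) := fun n =>
    (hlf (closedBall 0 (2 * R * n)) (isCompact_closedBall _ _)).toFinset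
  have hmem : ∀ n T, T ∈ 𝒜 n ↔ T ∈ 𝒯 ∧ (T ∩ closedBall 0 (2 * R * n)).Nonempty :=
    fun n T => Finite.mem_toFinset _
  have hmono : ∀ n, 𝒜 n ⊆ 𝒜 (n + 1) := fun n T hT => by
    rw [hmem] at hT ⊢
    refine ⟨hT.1, hT.2.mono (inter_subset_inter_right _ (closedBall_subset_closedBall ?_))⟩
    push_cast
    linarith
  have hp7 : (7 : ℝ) ≤ p := by exact_mod_cast hp
  refine not_le_sq_of_geometric_growth (g := fun n => ((𝒜 n).card : ℝ))
    (q := p / (p - 1)) (K := (2 * R / r) ^ 2) ?_ ?_ ?_ ?_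
  · rw [one_lt_div (by linarith)]
    linarith
  · obtain ⟨T, hT, h0⟩ : (0 : Euc 2) ∈ ⋃₀ 𝒯 := h𝒯.2.1 ▸ mem_univ _
    have : 0 < (𝒜 0).card :=
      Finset.card_pos.2 ⟨T, (hmem 0 T).2 ⟨hT, 0, h0, mem_closedBall_self (by simp)⟩⟩
    exact_mod_cast this
  · intro n
    have hsub : boundaryTiles 𝒯 (𝒜 (n + 1)) ⊆ 𝒜 (n + 1) \ 𝒜 n := fun T hT => by
      obtain ⟨hT, v, hv, S, hS, hvS, hSn⟩ := mem_boundaryTiles.1 hT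
      refine Finset.mem_sdiff.2 ⟨hT, fun hTn => hSn ?_⟩
      obtain ⟨hT𝒯, y, hyT, hy⟩ := (hmem n T).1 hTn
      refine (hmem _ S).2 ⟨hS, v, hvS, ?_⟩
      rw [mem_closedBall_zero_iff] at hy ⊢
      have := hdiam T hT𝒯 v hv.1 y hyT
      push_cast
      linarith
    have hcard := Finset.card_le_card hsub
    rw [Finset.card_sdiff_of_subset (hmono n)] at hcard
    have hcard' : ((boundaryTiles 𝒯 (𝒜 (n + 1))).card : ℝ) ≤ (𝒜 (n + 1)).card - (𝒜 n).card := by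
      rw [← Nat.cast_sub (Finset.card_le_card (hmono n))]
      exact_mod_cast hcard
    have hmain := card_mul_le_card_boundaryTiles h𝒯 hlf hff hpoly
      (fun T hT => (htiles T hT).2) (𝒜 (n + 1)) (fun T hT => ((hmem _ T).1 hT).1)
    rw [div_mul_eq_mul_div, div_le_iff₀ (by linarith)]
    have h1 : ((𝒜 (n + 1)).card : ℝ) ≤ (p - 6) * (𝒜 (n + 1)).card :=
      le_mul_of_one_le_left (Nat.cast_nonneg _) (by linarith)
    have h2 := mul_le_mul_of_nonneg_left hcard' (show (0 : ℝ) ≤ p by linarith)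
    linarith
  · intro n
    have := card_mul_sq_le h𝒯 hpoly hr (ρ := 2 * R * (n + 1)) (by positivity)
      (fun T hT => (hnormal T hT).1) (𝒜 n) fun T hT => by
        obtain ⟨hT𝒯, y, hyT, hy⟩ := (hmem n T).1 hT
        refine ⟨hT𝒯, fun x hx => ?_⟩
        rw [mem_closedBall_zero_iff] at hy ⊢
        linarith [hdiam T hT𝒯 x hx y hyT]
    rw [← le_div_iff₀ (by positivity)] at this
    refine this.trans_eq ?_
    field_simp
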